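/- arXiv:1512.07474 — 3 statements merged into one kernel-verified Lean document; each statement's English description precedes it below -/
import Mathlib

section
/- Every separately continuous function f : X × Y → ℝ on the product of a Baire space X and a Valdivia compact Y has the Namioka property: there exists a dense G_δ set A ⊆ X such that f is jointly continuous at every point of A × Y. -/
open Set Filter Topology

/-- A maximal disjoint refinement: if every nonempty open subset of `W` contains some nonempty
`O i` with `i ∈ I`, then some subfamily of pairwise disjoint sets `O i` has a union dense in `W`. -/
theorem exists_pairwiseDisjoint_subset_closure_iUnion {X ι : Type*} [TopologicalSpace X]
    (O : ι → Set X) (I : Set ι) (W : Set X) (hW : IsOpen W)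
    (h : ∀ V ⊆ W, IsOpen V → V.Nonempty → ∃ i ∈ I, O i ⊆ V ∧ (O i).Nonempty) :
    ∃ J ⊆ I, J.PairwiseDisjoint O ∧ W ⊆ closure (⋃ i ∈ J, O i) := by
  obtain ⟨J, hJ⟩ := zorn_subset {J : Set ι | J ⊆ I ∧ J.PairwiseDisjoint O} (by
    intro c hc hchain
    refine ⟨⋃₀ c, ⟨sUnion_subset fun J hJ => (hc hJ).1, ?_⟩, fun J hJ => subset_sUnion_of_mem hJ⟩
    exact (pairwiseDisjoint_sUnion hchain.directedOn).2 fun J hJ => (hc hJ).2)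
  refine ⟨J, hJ.prop.1, hJ.prop.2, ?_⟩
  by_contra hsub
  obtain ⟨x, hxW, hx⟩ := not_subset.1 hsub
  obtain ⟨i, hiI, hiV, z, hz⟩ := h (W ∩ (closure (⋃ i ∈ J, O i))ᶜ) inter_subset_left
    (hW.inter isClosed_closure.isOpen_compl) ⟨x, hxW, hx⟩
  have hdisj : ∀ j ∈ J, Disjoint (O i) (O j) := fun j hj =>
    disjoint_left.2 fun w hwi hwj => (hiV hwi).2 (subset_closure (mem_biUnion hj hwj))
  have hmem : i ∈ J := hJ.le_of_ge
    (y := insert i J)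
    ⟨insert_subset hiI hJ.prop.1, hJ.prop.2.insert fun j hj _ => hdisj j hj⟩
    (subset_insert i J) (mem_insert i J)
  exact disjoint_left.1 (hdisj i hmem) hz hz

/-- In a Baire space the first player of the Banach-Mazur game has no winning strategy:
if moves `R` are always available inside any nonempty open subset of the current open set `O s`,
then some infinite play has nonempty intersection. -/
theorem exists_play_mem_iInter {X σ : Type*} [TopologicalSpace X] [BaireSpace X]
    (O : σ → Set X) (hO : ∀ s, IsOpen (O s)) (R : σ → σ → Prop) (s₀ : σ)
    (h₀ : (O s₀).Nonempty)
    (h : ∀ s, O s ⊆ O s₀ → ∀ V ⊆ O s, IsOpen V → V.Nonempty →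
      ∃ t, R s t ∧ O t ⊆ V ∧ (O t).Nonempty) :
    ∃ (u : ℕ → σ) (x : X), u 0 = s₀ ∧ (∀ n, R (u n) (u (n + 1))) ∧ ∀ n, x ∈ O (u n) := by
  have key : ∀ s, ∃ J : Set σ, O s ⊆ O s₀ → J ⊆ {t | R s t ∧ O t ⊆ O s} ∧
      J.PairwiseDisjoint O ∧ O s ⊆ closure (⋃ i ∈ J, O i) := by
    intro s
    by_cases hs : O s ⊆ O s₀
    · obtain ⟨J, hJ⟩ := exists_pairwiseDisjoint_subset_closure_iUnion O
        {t | R s t ∧ O t ⊆ O s} (O s) (hO s) (by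
          intro V hV hVo hVn
          obtain ⟨t, ht, htV, htn⟩ := h s hs V hV hVo hVn
          exact ⟨t, ⟨ht, htV.trans hV⟩, htV, htn⟩)
      exact ⟨J, fun _ => hJ⟩
    · exact ⟨∅, fun h => absurd h hs⟩
  choose G hG using key
  let L : ℕ → Set σ := fun n => Nat.rec {s₀} (fun _ A => ⋃ s ∈ A, G s) n
  have hL : ∀ n t, t ∈ L (n + 1) ↔ ∃ s ∈ L n, t ∈ G s := by
    intro n t
    change t ∈ ⋃ s ∈ L n, G s ↔ _
    simp
  have hsub : ∀ n, ∀ s ∈ L n, O s ⊆ O s₀ := by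
    intro n
    induction n with
    | zero => exact fun s hs => (congrArg O (show s = s₀ from hs)).subset
    | succ n ih =>
      intro t ht
      obtain ⟨s, hs, hts⟩ := (hL n t).1 ht
      exact ((hG s (ih s hs)).1 hts).2.trans (ih s hs)
  have huniq : ∀ n, ∀ s ∈ L n, ∀ t ∈ L n, ∀ x, x ∈ O s → x ∈ O t → s = t := by
    intro n
    induction n with
    | zero => exact fun s hs t ht _ _ _ => (show s = s₀ from hs).trans (show t = s₀ from ht).symm
    | succ n ih =>
      intro s hs t ht x hxs hxt
      obtain ⟨p, hp, hsp⟩ := (hL n s).1 hs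
      obtain ⟨q, hq, htq⟩ := (hL n t).1 ht
      have hGp := hG p (hsub n p hp)
      obtain rfl := ih p hp q hq x ((hGp.1 hsp).2 hxs) (((hG q (hsub n q hq)).1 htq).2 hxt)
      exact hGp.2.1.elim_set hsp htq x hxs hxt
  have hdense : ∀ n, O s₀ ⊆ closure (⋃ s ∈ L n, O s) := by
    intro n
    induction n with
    | zero =>
      exact subset_closure.trans (closure_mono (subset_biUnion_of_mem (u := O) (rfl : s₀ ∈ L 0)))
    | succ n ih =>
      refine ih.trans (closure_minimal (iUnion₂_subset fun s hs => ?_) isClosed_closure)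
      refine (hG s (hsub n s hs)).2.2.trans (closure_mono (iUnion₂_subset fun t ht => ?_))
      exact subset_biUnion_of_mem (u := O) ((hL n t).2 ⟨s, hs, ht⟩)
  have hLo : ∀ n, IsOpen (⋃ s ∈ L n, O s) := fun n => isOpen_biUnion fun s _ => hO s
  have hD : Dense (⋂ n, ((⋃ s ∈ L n, O s) ∪ (closure (O s₀))ᶜ)) := by
    refine dense_iInter_of_isOpen (fun n => (hLo n).union isClosed_closure.isOpen_compl)
      fun n x => ?_
    by_cases hx : x ∈ closure (O s₀)
    · exact closure_mono subset_union_left (closure_minimal (hdense n) isClosed_closure hx)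
    · exact subset_closure (Or.inr hx)
  obtain ⟨x, hx₀, hx⟩ := hD.inter_open_nonempty _ (hO s₀) h₀
  have hmem : ∀ n, ∃ s ∈ L n, x ∈ O s := by
    intro n
    rcases mem_iInter.1 hx n with hn | hn
    · simpa using hn
    · exact absurd (subset_closure hx₀) hn
  choose u hu hxu using hmem
  refine ⟨u, x, hu 0, fun n => ?_, hxu⟩
  obtain ⟨s, hs, hus⟩ := (hL n _).1 (hu (n + 1))
  have hGs := (hG s (hsub n s hs)).1 hus
  obtain rfl := huniq n s hs (u n) (hu n) x (hGs.2 (hxu (n + 1))) (hxu n)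
  exact hGs.1

theorem Set.Countable.exists_finset_seq {S : Type*} {K : Set S} (hK : K.Countable) :
    ∃ F : ℕ → Finset S, ∀ s ∈ K, ∃ m, ∀ n ≥ m, s ∈ F n := by
  classical
  rcases isEmpty_or_nonempty S with hS | hS
  · exact ⟨fun _ => ∅, fun s => isEmptyElim s⟩
  · obtain ⟨g, hg⟩ := countable_iff_exists_subset_range.1 hK
    refine ⟨fun n => (Finset.range (n + 1)).image g, fun s hs => ?_⟩
    obtain ⟨m, rfl⟩ := hg hs
    exact ⟨m, fun n hn => Finset.mem_image_of_mem g (Finset.mem_range.2 (by omega))⟩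

/-- If `f` oscillates by at most `ε` between points of a dense set `D` that are close in finitely
many coordinates, then `f` has uniformly small oscillation on some open set. -/
theorem exists_isOpen_forall_abs_sub_le {X Y S : Type*} [TopologicalSpace X]
    [TopologicalSpace Y] [CompactSpace Y] {φ : Y → S → ℝ} (hφ : Continuous φ)
    {D : Set Y} (hD : Dense D) {f : X → Y → ℝ}
    (hf1 : ∀ y, Continuous fun x => f x y) (hf2 : ∀ x, Continuous (f x))
    (F : Finset S) {δ ε : ℝ} (hδ : 0 < δ) (hε : 0 < ε) {V : Set X} (hV : IsOpen V)
    (hVn : V.Nonempty)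
    (h : ∀ x ∈ V, ∀ y ∈ D, ∀ z ∈ D, (∀ s ∈ F, |φ y s - φ z s| < δ) → |f x y - f x z| ≤ ε) :
    ∃ U ⊆ V, IsOpen U ∧ U.Nonempty ∧ ∀ x ∈ U, ∀ x' ∈ U, ∀ y, |f x y - f x' y| ≤ 6 * ε := by
  have hs : ∀ s, Continuous fun y => φ y s := fun s => (continuous_apply s).comp hφ
  have hB : ∀ c : Y, IsOpen {y | ∀ s ∈ F, |φ y s - φ c s| < δ} := by
    intro c
    simp only [ofPred_forall]
    exact isOpen_biInter_finset fun s _ =>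
      isOpen_lt (((hs s).sub continuous_const).abs) continuous_const
  obtain ⟨t, ht⟩ := isCompact_univ.elim_finite_subcover
    (fun c : D => {y | ∀ s ∈ F, |φ y s - φ c s| < δ}) (fun c => hB c) (by
      intro y _
      obtain ⟨c, hc, hcD⟩ := hD.inter_open_nonempty _ (hB y) ⟨y, by simpa using fun _ _ => hδ⟩
      exact mem_iUnion.2 ⟨⟨c, hcD⟩, fun s hsF => by
        rw [abs_sub_comm]
        exact hc s hsF⟩)
  obtain ⟨x₀, hx₀⟩ := hVn
  let U : Set X := V ∩ ⋂ c ∈ t, {x | |f x c - f x₀ c| < ε}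
  have hUx : ∀ x ∈ U, ∀ y, |f x y - f x₀ y| ≤ 3 * ε := by
    intro x hx y
    have hcl : IsClosed {y | |f x y - f x₀ y| ≤ 3 * ε} :=
      isClosed_le ((hf2 x).sub (hf2 x₀)).abs continuous_const
    refine closure_minimal (fun y hy => ?_) hcl (hD y)
    obtain ⟨c, hct, hc⟩ := mem_iUnion₂.1 (ht (mem_univ y))
    have h1 := h x hx.1 y hy c c.2 hc
    have h2 := h x₀ hx₀ y hy c c.2 hc
    have h3 : |f x c - f x₀ c| < ε := mem_iInter₂.1 hx.2 c hct
    rw [mem_ofPred_eq]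
    rw [abs_le] at *
    rw [abs_lt] at h3
    constructor <;> linarith
  refine ⟨U, inter_subset_left, hV.inter (isOpen_biInter_finset fun c _ =>
    isOpen_lt ((hf1 c).sub continuous_const).abs continuous_const), ⟨x₀, hx₀, ?_⟩, ?_⟩
  · simpa using fun _ _ _ => hε
  · intro x hx x' hx' y
    have h1 := hUx x hx y
    have h2 := hUx x' hx' y
    rw [abs_le] at *
    constructor <;> linarith

/-- Points where a separately continuous function has small oscillation, uniformly in the compact
variable, are dense. -/
theorem dense_sUnion_forall_abs_sub_le {X Y S : Type*} [TopologicalSpace X] [BaireSpace X]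
    [TopologicalSpace Y] [CompactSpace Y] {φ : Y → S → ℝ} (hφ : Continuous φ)
    (hinj : Function.Injective φ) (hD : Dense {y | {s | φ y s ≠ 0}.Countable}) {f : X → Y → ℝ}
    (hf1 : ∀ y, Continuous fun x => f x y) (hf2 : ∀ x, Continuous (f x)) {ε : ℝ} (hε : 0 < ε) :
    Dense (⋃₀ {U : Set X | IsOpen U ∧ ∀ x ∈ U, ∀ x' ∈ U, ∀ y, |f x y - f x' y| ≤ ε}) := by
  rw [dense_iff_inter_open]
  intro W hW hWn
  by_contra hempty
  have hosc : ∀ U ⊆ W, IsOpen U → U.Nonempty →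
      ¬ ∀ x ∈ U, ∀ x' ∈ U, ∀ y, |f x y - f x' y| ≤ ε := fun U hUW hU ⟨x, hx⟩ hsmall =>
    hempty ⟨x, hUW hx, U, ⟨hU, hsmall⟩, hx⟩
  have hF : ∀ y, ∃ F : ℕ → Finset S, {s | φ y s ≠ 0}.Countable →
      ∀ s, φ y s ≠ 0 → ∃ m, ∀ n ≥ m, s ∈ F n := by
    intro y
    by_cases hy : {s | φ y s ≠ 0}.Countable
    · obtain ⟨F, hF⟩ := hy.exists_finset_seq
      exact ⟨F, fun _ => hF⟩
    · exact ⟨fun _ => ∅, fun h => absurd h hy⟩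
  choose F hF using hF
  obtain ⟨u, x, -, hu, hx⟩ := exists_play_mem_iInter
    (σ := List (Y × Y) × TopologicalSpace.Opens X)
    (fun s => (s.2 : Set X)) (fun s => s.2.isOpen)
    (fun s t => ∃ p : Y × Y, t.1 = p :: s.1 ∧ {i | φ p.1 i ≠ 0}.Countable ∧
      {i | φ p.2 i ≠ 0}.Countable ∧
      (∀ q ∈ s.1, ∀ i, i ∈ F q.1 s.1.length ∨ i ∈ F q.2 s.1.length →
        |φ p.1 i - φ p.2 i| < 1 / ((s.1.length : ℝ) + 1)) ∧
      ∀ x ∈ t.2, ε / 6 ≤ |f x p.1 - f x p.2|)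
    ([], ⟨W, hW⟩) hWn (by
      classical
      rintro ⟨l, O⟩ hOW V hVO hV hVn
      by_contra! hno
      obtain ⟨U, hUV, hU, hUn, hsmall⟩ := exists_isOpen_forall_abs_sub_le hφ hD hf1 hf2
        (l.toFinset.biUnion fun q => F q.1 l.length ∪ F q.2 l.length)
        (δ := 1 / ((l.length : ℝ) + 1)) (by positivity) (ε := ε / 6) (by positivity) hV hVn (by
          intro x hx y hy z hz hyz
          by_contra! hlt
          let U : TopologicalSpace.Opens X := ⟨V ∩ {x | ε / 6 < |f x y - f x z|},
            hV.inter (isOpen_lt continuous_const ((hf1 y).sub (hf1 z)).abs)⟩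
          have hxU : x ∈ (U : Set X) := ⟨hx, hlt⟩
          rw [hno ((y, z) :: l, U) ⟨(y, z), rfl, hy, hz, fun q hq i hi => hyz i ?_,
            fun x hx => hx.2.le⟩ inter_subset_left] at hxU
          · exact hxU
          · exact Finset.mem_biUnion.2 ⟨q, List.mem_toFinset.2 hq, Finset.mem_union.2 hi⟩)
      refine hosc U (hUV.trans (hVO.trans hOW)) hU hUn ?_
      rwa [mul_div_cancel₀ ε (by norm_num : (6 : ℝ) ≠ 0)] at hsmall)
  choose p hpu hp₁ hp₂ hclose hfar using hu
  have hlen : ∀ n, n ≤ (u n).1.length := by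
    intro n
    induction n with
    | zero => exact Nat.zero_le _
    | succ n ih => rw [hpu n, List.length_cons]; omega
  have hmem : ∀ m n, m < n → p m ∈ (u n).1 := by
    intro m n hmn
    induction n, hmn using Nat.le_induction with
    | base => simp [hpu m]
    | succ n _ ih => rw [hpu n]; exact List.mem_cons_of_mem _ ih
  let 𝒰 : Ultrafilter ℕ := hyperfilter ℕ
  have h𝒰 : (𝒰 : Filter ℕ) ≤ atTop := Nat.hyperfilter_le_atTop
  obtain ⟨a, -, ha⟩ := isCompact_univ.ultrafilter_le_nhds (𝒰.map fun n => (p n).1) (by simp)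
  obtain ⟨b, -, hb⟩ := isCompact_univ.ultrafilter_le_nhds (𝒰.map fun n => (p n).2) (by simp)
  have ha' : Tendsto (fun n => (p n).1) 𝒰 (𝓝 a) := ha
  have hb' : Tendsto (fun n => (p n).2) 𝒰 (𝓝 b) := hb
  have hlim : Tendsto (fun n => |f x (p n).1 - f x (p n).2|) 𝒰 (𝓝 |f x a - f x b|) :=
    ((((hf2 x).tendsto a).comp ha').sub (((hf2 x).tendsto b).comp hb')).abs
  have hge : ε / 6 ≤ |f x a - f x b| :=
    ge_of_tendsto hlim (Eventually.of_forall fun n => hfar n x (hx (n + 1)))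
  have hab : a = b := by
    refine hinj (funext fun i => ?_)
    have hc : Continuous fun y => φ y i := (continuous_apply i).comp hφ
    have hlim : Tendsto (fun n => φ (p n).1 i - φ (p n).2 i) 𝒰 (𝓝 (φ a i - φ b i)) :=
      ((hc.tendsto a).comp ha').sub ((hc.tendsto b).comp hb')
    suffices h : Tendsto (fun n => φ (p n).1 i - φ (p n).2 i) atTop (𝓝 0) from
      sub_eq_zero.1 (tendsto_nhds_unique hlim (h.mono_left h𝒰))
    by_cases hi : ∀ n, φ (p n).1 i = 0 ∧ φ (p n).2 i = 0
    · simp [hi]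
    · obtain ⟨k, m, hm⟩ : ∃ k m, ∀ n ≥ m, i ∈ F (p k).1 n ∨ i ∈ F (p k).2 n := by
        simp only [not_forall, not_and_or] at hi
        obtain ⟨k, hk | hk⟩ := hi
        · obtain ⟨m, hm⟩ := hF _ (hp₁ k) i hk
          exact ⟨k, m, fun n hn => Or.inl (hm n hn)⟩
        · obtain ⟨m, hm⟩ := hF _ (hp₂ k) i hk
          exact ⟨k, m, fun n hn => Or.inr (hm n hn)⟩
      refine squeeze_zero_norm' ?_ tendsto_one_div_add_atTop_nhds_zero_nat
      filter_upwards [eventually_gt_atTop k, eventually_ge_atTop m] with n hkn hmn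
      refine (hclose n (p k) (hmem k n hkn) i (hm _ (hmn.trans (hlen n)))).le.trans ?_
      exact one_div_le_one_div_of_le (by positivity) (by exact_mod_cast Nat.succ_le_succ (hlen n))
  rw [hab, sub_self, abs_zero] at hge
  linarith


/-- Corollary 3.2: every separately continuous real function on the product of
a Baire space and a Valdivia compact (a compact space homeomorphic to a compact
`Z ⊆ ℝ^S` in which the points of countable support are dense) has the Namioka
property. -/
theorem stmt9 {X Y S : Type*} [TopologicalSpace X] [BaireSpace X]
    [TopologicalSpace Y] [CompactSpace Y]
    (Z : Set (S → ℝ)) (hZ : IsCompact Z)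
    (hdense : Dense {z : Z | {s : S | (z : S → ℝ) s ≠ 0}.Countable})
    (e : Y ≃ₜ Z)
    (f : X → Y → ℝ)
    (hf1 : ∀ y : Y, Continuous fun x => f x y) (hf2 : ∀ x : X, Continuous (f x)) :
    ∃ A : Set X, Dense A ∧ IsGδ A ∧
      ∀ a ∈ A, ∀ y : Y, ContinuousAt (fun p : X × Y => f p.1 p.2) (a, y) := by
  let φ : Y → S → ℝ := fun y => (e y : S → ℝ)
  have hφ : Continuous φ := continuous_subtype_val.comp e.continuous
  have hinj : Function.Injective φ := Subtype.val_injective.comp e.injective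
  have hD : Dense {y | {s | φ y s ≠ 0}.Countable} := hdense.preimage e.isOpenMap
  let G : ℝ → Set X := fun ε =>
    ⋃₀ {U : Set X | IsOpen U ∧ ∀ x ∈ U, ∀ x' ∈ U, ∀ y, |f x y - f x' y| ≤ ε}
  have hG : ∀ ε, IsOpen (G ε) := fun ε => isOpen_sUnion fun U hU => hU.1
  refine ⟨⋂ n : ℕ, G (1 / ((n : ℝ) + 1)), ?_, IsGδ.iInter_of_isOpen fun n => hG _, ?_⟩
  · exact dense_iInter_of_isOpen (fun n => hG _) fun n =>
      dense_sUnion_forall_abs_sub_le hφ hinj hD hf1 hf2 Nat.one_div_pos_of_nat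
  · intro a ha y
    rw [Metric.continuousAt_iff']
    intro ε hε
    obtain ⟨n, hn⟩ := exists_nat_one_div_lt (half_pos hε)
    obtain ⟨U, ⟨hU, hsmall⟩, haU⟩ := mem_iInter.1 ha n
    have hy : ∀ᶠ z in 𝓝 y, dist (f a z) (f a y) < ε / 2 :=
      Metric.continuousAt_iff'.1 (hf2 a).continuousAt _ (half_pos hε)
    filter_upwards [prod_mem_nhds (hU.mem_nhds haU) hy] with q hq
    have h1 : dist (f q.1 q.2) (f a q.2) ≤ 1 / ((n : ℝ) + 1) := hsmall q.1 hq.1 a haU q.2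
    have h2 : dist (f a q.2) (f a y) < ε / 2 := hq.2
    linarith [dist_triangle (f q.1 q.2) (f a q.2) (f a y)]
end

section
/- Let X be a topological space, E ⊆ X a bounded subset (i.e., g(E) is a bounded subset of ℝ for every continuous g : X → ℝ), and Y ⊆ C_p(X) a compact subspace. Then the image φ(Y) under the restriction map φ : C_p(X) → C_p(E), φ(y) = y|_E, is an Eberlein compact; in particular it is a Corson compact. -/
universe u v w

/-- An Eberlein compact: a compact space homeomorphic to a compact subset of
`C_p(K)` for some compact space `K`. -/
def IsEberleinCompact (K' : Type u) [TopologicalSpace K'] : Prop :=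
  CompactSpace K' ∧ ∃ (K : Type v) (_ : TopologicalSpace K), CompactSpace K ∧
    ∃ W : Set (K → ℝ), (∀ w ∈ W, Continuous w) ∧ IsCompact W ∧ Nonempty (K' ≃ₜ W)

/-- A Corson compact: a compact space homeomorphic to a compact `Z ⊆ ℝ^S`
in which every point has countable support. -/
def IsCorsonCompact (K : Type u) [TopologicalSpace K] : Prop :=
  CompactSpace K ∧ ∃ (S : Type v) (Z : Set (S → ℝ)), IsCompact Z ∧
    (∀ z ∈ Z, {s : S | z s ≠ 0}.Countable) ∧ Nonempty (K ≃ₜ Z)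

open Set Filter Topology

theorem mem_closure_pi_real_iff {ι : Type*} {S : Set (ι → ℝ)} {f : ι → ℝ} :
    f ∈ closure S ↔ ∀ (t : Finset ι) (ε : ℝ), 0 < ε → ∃ g ∈ S, ∀ i ∈ t, |g i - f i| < ε := by
  rw [mem_closure_iff]
  constructor
  · intro h t ε hε
    have hopen : IsOpen {g : ι → ℝ | ∀ i ∈ t, |g i - f i| < ε} := by
      have : {g : ι → ℝ | ∀ i ∈ t, |g i - f i| < ε} = ⋂ i ∈ t, {g | |g i - f i| < ε} := by
        ext; simp
      rw [this]
      exact isOpen_biInter_finset fun i _ => isOpen_lt (by fun_prop) continuous_const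
    obtain ⟨g, hg, hgS⟩ := h _ hopen (by simpa using fun _ _ => hε)
    exact ⟨g, hgS, hg⟩
  · intro h o ho hf
    obtain ⟨I, u, hu, hsub⟩ := isOpen_pi_iff.1 ho f hf
    have key : ∀ᶠ ε in 𝓝[>] (0 : ℝ), ∀ i ∈ I, Metric.ball (f i) ε ⊆ u i := by
      rw [Filter.eventually_all_finset]
      intro i hi
      obtain ⟨ε, hε, hball⟩ := Metric.isOpen_iff.1 (hu i hi).1 _ (hu i hi).2
      filter_upwards [Ioo_mem_nhdsGT hε] with δ hδ
      exact (Metric.ball_subset_ball hδ.2.le).trans hball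
    obtain ⟨ε, hball, hε⟩ := (key.and self_mem_nhdsWithin).exists
    obtain ⟨g, hgS, hg⟩ := h I ε hε
    exact ⟨g, hsub fun i hi => hball i hi (by simpa [Real.dist_eq] using hg i hi), hgS⟩

/-- Grothendieck's theorem for functionally bounded sets: if `E` is bounded in `X` and `Y` is
compact in `C_p(X)`, then pointwise limits on `Y` of evaluations at points of `E` are continuous. -/
theorem continuous_of_mem_closure_range_eval {X : Type*} [TopologicalSpace X] {E : Set X}
    (hE : ∀ g : X → ℝ, Continuous g → Bornology.IsBounded (g '' E))
    {Y : Set (X → ℝ)} (hYc : ∀ y ∈ Y, Continuous y) (hY : IsCompact Y) {f : Y → ℝ}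
    (hf : f ∈ closure (range fun (e : E) (y : Y) => y.1 e)) : Continuous f := by
  have : CompactSpace Y := isCompact_iff_compactSpace.1 hY
  have heval (x : X) : Continuous fun y : Y => y.1 x :=
    (continuous_apply x).comp continuous_subtype_val
  rw [continuous_iff_continuousAt]
  by_contra! hcon
  obtain ⟨y₀, hy₀⟩ := hcon
  rw [Metric.continuousAt_iff'] at hy₀
  push Not at hy₀
  obtain ⟨ε, hε, hfreq⟩ := hy₀
  rw [mem_closure_pi_real_iff] at hf
  have hinv (n : ℕ) : (0 : ℝ) < 1 / ((n : ℝ) + 1) := by positivity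
  -- alternately choose points of `E` and points of `Y`, indexed by their quality
  obtain ⟨s, hsP, hsr⟩ := exists_seq_of_forall_finset_exists (α := ℕ × E × Y)
    (fun p => ε ≤ |f p.2.2 - f y₀| ∧ |y₀.1 p.2.1 - f y₀| < 1 / ((p.1 : ℝ) + 1))
    (fun p q => p.1 < q.1 ∧ |p.2.2.1 q.2.1 - f p.2.2| < 1 / ((q.1 : ℝ) + 1) ∧
      |q.2.2.1 p.2.1 - y₀.1 p.2.1| < 1 / ((q.1 : ℝ) + 1)) (by
    classical
    intro t _
    obtain ⟨n, hn⟩ : ∃ n : ℕ, ∀ p ∈ t, p.1 < n :=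
      ⟨t.sup Prod.fst + 1, fun p hp => Nat.lt_succ_of_le (Finset.le_sup (f := Prod.fst) hp)⟩
    obtain ⟨-, ⟨e, rfl⟩, he⟩ := hf (insert y₀ (t.image fun p => p.2.2)) _ (hinv n)
    have hnear : ∀ᶠ y in 𝓝 y₀, ∀ p ∈ t, |y.1 p.2.1 - y₀.1 p.2.1| < 1 / ((n : ℝ) + 1) := by
      rw [Filter.eventually_all_finset]
      intro p _
      simpa [Real.dist_eq] using
        Metric.tendsto_nhds.1 ((heval p.2.1).tendsto y₀) _ (hinv n)
    obtain ⟨y, hy, hy'⟩ := (hfreq.and_eventually hnear).exists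
    refine ⟨(n, e, y), ⟨by simpa [Real.dist_eq] using hy, he _ (by simp)⟩, fun p hp =>
      ⟨hn p hp, he _ ?_, hy' p hp⟩⟩
    exact Finset.mem_insert_of_mem (Finset.mem_image_of_mem _ hp))
  set a : ℕ → E := fun n => (s n).2.1
  set y : ℕ → Y := fun n => (s n).2.2
  have hmono : StrictMono fun n => (s n).1 := fun m n h => (hsr m n h).1
  have hzero : Tendsto (fun n => 1 / (((s n).1 : ℝ) + 1)) atTop (𝓝 0) :=
    tendsto_one_div_add_atTop_nhds_zero_nat.comp hmono.tendsto_atTop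
  have hlim {u : ℕ → ℝ} {c : ℝ} (h : ∀ᶠ n in atTop, |u n - c| < 1 / (((s n).1 : ℝ) + 1)) :
      Tendsto u atTop (𝓝 c) := by
    rw [tendsto_iff_dist_tendsto_zero]
    refine squeeze_zero' (Eventually.of_forall fun _ => dist_nonneg) ?_ hzero
    filter_upwards [h] with n hn using (Real.dist_eq _ _).trans_le hn.le
  have hay (n : ℕ) : Tendsto (fun m => (y n).1 (a m)) atTop (𝓝 (f (y n))) :=
    hlim (by filter_upwards [eventually_gt_atTop n] with m hm using (hsr n m hm).2.1)
  have hay₀ : Tendsto (fun m => y₀.1 (a m)) atTop (𝓝 (f y₀)) :=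
    hlim (Eventually.of_forall fun m => (hsP m).2)
  have hya (m : ℕ) : Tendsto (fun n => (y n).1 (a m)) atTop (𝓝 (y₀.1 (a m))) :=
    hlim (by filter_upwards [eventually_gt_atTop m] with n hn using (hsr m n hn).2.2)
  obtain ⟨z, hz⟩ : ∃ z, Tendsto y (hyperfilter ℕ) (𝓝 z) :=
    ⟨_, ((hyperfilter ℕ).map y).le_nhds_lim⟩
  have hza (m : ℕ) : z.1 (a m) = y₀.1 (a m) :=
    tendsto_nhds_unique (((heval (a m)).tendsto z).comp hz)
      ((hya m).mono_left Nat.hyperfilter_le_atTop)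
  -- `D` measures the distance to the discontinuous limit on `z, y 0, y 1, …`
  let d : ℕ → X → ℝ := fun n x => (1 / 2) ^ n * min 1 |(y n).1 x - f (y n)|
  let D : X → ℝ := fun x => (∑' n, d n x) + |z.1 x - f y₀|
  have hsum : Summable fun n : ℕ => ((1 : ℝ) / 2) ^ n := summable_geometric_two
  have hd0 (n x) : 0 ≤ d n x := by positivity
  have hdle (n x) : ‖d n x‖ ≤ (1 / 2) ^ n := by
    rw [Real.norm_of_nonneg (hd0 n x)]
    exact mul_le_of_le_one_right (by positivity) (min_le_left _ _)
  have hdsum (x) : Summable fun n => d n x := hsum.of_norm_bounded fun n => hdle n x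
  have hDc : Continuous D := by
    refine (continuous_tsum (fun n => ?_) hsum hdle).add ?_
    · have := hYc _ (y n).2
      fun_prop
    · have := hYc _ z.2
      fun_prop
  have hDpos (x) : 0 < D x := by
    refine lt_of_le_of_ne (add_nonneg (tsum_nonneg fun n => hd0 n x) (abs_nonneg _)) fun h0 => ?_
    have h1 : (∑' n, d n x) = 0 ∧ |z.1 x - f y₀| = 0 :=
      (add_eq_zero_iff_of_nonneg (tsum_nonneg fun n => hd0 n x) (abs_nonneg _)).1 h0.symm
    have h2 (n : ℕ) : (y n).1 x = f (y n) := by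
      have h3 : d n x = 0 :=
        congrFun ((hasSum_zero_iff_of_nonneg fun n => hd0 n x).1 ((hdsum x).hasSum_iff.2 h1.1)) n
      have h4 : min 1 |(y n).1 x - f (y n)| = 0 := by
        simpa [d] using h3
      rcases min_choice 1 |(y n).1 x - f (y n)| with h | h
      · rw [h] at h4; norm_num at h4
      · rw [h] at h4; linarith [abs_eq_zero.1 h4]
    have h5 : Tendsto (fun n => |(y n).1 x - f y₀|) (hyperfilter ℕ) (𝓝 |z.1 x - f y₀|) :=
      ((((heval x).tendsto z).comp hz).sub_const _).abs
    have h6 : ε ≤ |z.1 x - f y₀| :=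
      ge_of_tendsto h5 (Eventually.of_forall fun n => by rw [h2]; exact (hsP n).1)
    linarith [h1.2]
  have hDlim : Tendsto (fun m => D (a m)) atTop (𝓝 0) := by
    have h1 : Tendsto (fun m => ∑' n, d n (a m)) atTop (𝓝 (∑' _ : ℕ, (0 : ℝ))) := by
      refine tendsto_tsum_of_dominated_convergence hsum (fun n => ?_)
        (Eventually.of_forall fun m n => hdle n (a m))
      have := ((tendsto_const_nhds (x := (1 : ℝ))).min ((hay n).sub_const (f (y n))).abs).const_mul
        ((1 / 2 : ℝ) ^ n)
      simpa [d] using this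
    have h2 : Tendsto (fun m => |z.1 (a m) - f y₀|) atTop (𝓝 0) := by
      simpa [hza] using (hay₀.sub_const (f y₀)).abs
    simpa [D] using h1.add h2
  obtain ⟨C, hC⟩ := (hE (fun x => (D x)⁻¹) (hDc.inv₀ fun x => (hDpos x).ne')).exists_norm_le
  have hinf : Tendsto (fun m => (D (a m))⁻¹) atTop atTop :=
    (tendsto_nhdsWithin_iff.2 ⟨hDlim, Eventually.of_forall fun m => hDpos _⟩).inv_tendsto_nhdsGT_zero
  obtain ⟨m, hm⟩ := (hinf.eventually_gt_atTop C).exists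
  exact absurd (hC _ ⟨a m, (a m).2, rfl⟩) (not_le.2 (hm.trans_le (le_abs_self _)))

theorem isEberleinCompact_image_restrict {X : Type u} [TopologicalSpace X] (E : Set X)
    (hE : ∀ g : X → ℝ, Continuous g → Bornology.IsBounded (g '' E))
    (Y : Set (X → ℝ)) (hYc : ∀ y ∈ Y, Continuous y) (hY : IsCompact Y) :
    IsEberleinCompact.{u, u} ((fun (y : X → ℝ) (e : E) => y e) '' Y) := by
  have hrestr : Continuous fun (y : X → ℝ) (e : E) => y e := by fun_prop
  have : CompactSpace Y := isCompact_iff_compactSpace.1 hY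
  let ψ : E → Y → ℝ := fun e y => y.1 e
  let K : Set (Y → ℝ) := closure (range ψ)
  have hKc : IsCompact K := by
    choose C hC using fun y : Y => (hE y.1 (hYc _ y.2)).exists_norm_le
    refine (isCompact_univ_pi fun y => isCompact_closedBall (0 : ℝ) (C y)).of_isClosed_subset
      isClosed_closure (closure_minimal ?_ (isClosed_set_pi fun y _ => Metric.isClosed_closedBall))
    rintro - ⟨e, rfl⟩ y -
    simpa using hC y _ ⟨e, e.2, rfl⟩
  have hψ (e : E) : ψ e ∈ K := subset_closure ⟨e, rfl⟩
  let ev : Y → K → ℝ := fun y k => k.1 y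
  have hev : Continuous ev :=
    continuous_pi fun k => continuous_of_mem_closure_range_eval hE hYc hY k.2
  refine ⟨isCompact_iff_compactSpace.1 (hY.image hrestr), K, inferInstance,
    isCompact_iff_compactSpace.1 hKc, range ev, ?_, isCompact_range hev, ?_⟩
  · rintro - ⟨y, rfl⟩
    exact (continuous_apply y).comp continuous_subtype_val
  have : CompactSpace (range ev) := isCompact_iff_compactSpace.1 (isCompact_range hev)
  let Φ : range ev → (fun (y : X → ℝ) (e : E) => y e) '' Y :=
    fun w => ⟨fun e => w.1 ⟨ψ e, hψ e⟩, by
      obtain ⟨-, y, rfl⟩ := w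
      exact ⟨y, y.2, rfl⟩⟩
  have hΦ : Continuous Φ := by
    refine Continuous.subtype_mk (continuous_pi fun e => ?_) _
    exact (continuous_apply _).comp continuous_subtype_val
  have hbij : Function.Bijective Φ := by
    constructor
    · rintro ⟨-, y, rfl⟩ ⟨-, y', rfl⟩ h
      have h' (e : E) : y.1 e = y'.1 e := congrFun (congrArg Subtype.val h) e
      have hcl : K ⊆ {k | k y = k y'} :=
        closure_minimal (by rintro - ⟨e, rfl⟩; exact h' e)
          (isClosed_eq (continuous_apply _) (continuous_apply _))
      exact Subtype.ext (funext fun k => hcl k.2)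
    · rintro ⟨-, y, hy, rfl⟩
      exact ⟨⟨ev ⟨y, hy⟩, mem_range_self _⟩, rfl⟩
  exact ⟨(Continuous.homeoOfEquivCompactToT2 (f := Equiv.ofBijective Φ hbij) hΦ).symm⟩

theorem exists_finitary_hull {V : Type*} (g : Finset V → Set V) (hg : ∀ s, (g s).Countable) :
    ∃ H : Set V → Set V, (∀ M, M ⊆ H M) ∧ Monotone H ∧ (∀ M, M.Countable → (H M).Countable) ∧
      (∀ M (s : Finset V), ↑s ⊆ H M → g s ⊆ H M) ∧
      ∀ {κ : Type _} [Nonempty κ] (M : κ → Set V), Directed (· ⊆ ·) M →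
        H (⋃ i, M i) ⊆ ⋃ i, H (M i) := by
  let C : Set V → Set (Set V) := fun M => {N | M ⊆ N ∧ ∀ s : Finset V, ↑s ⊆ N → g s ⊆ N}
  have hsub (M) : M ⊆ ⋂₀ C M := subset_sInter fun N hN => hN.1
  have hclosed (M) (s : Finset V) (hs : ↑s ⊆ ⋂₀ C M) : g s ⊆ ⋂₀ C M :=
    subset_sInter fun N hN => hN.2 s (hs.trans (sInter_subset_of_mem hN))
  have hmono : Monotone fun M => ⋂₀ C M := fun M M' h =>
    sInter_subset_sInter fun N hN => ⟨h.trans hN.1, hN.2⟩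
  refine ⟨fun M => ⋂₀ C M, hsub, hmono, fun M hM => ?_, hclosed, fun {κ} _ M hdir => ?_⟩
  · let step : Set V → Set V := fun N => N ∪ ⋃ s ∈ {s : Finset V | ↑s ⊆ N}, g s
    have hstep (N : Set V) (hN : N.Countable) : (step N).Countable := by
      refine hN.union (Countable.biUnion ?_ fun s _ => hg s)
      have := hN.to_subtype
      refine (countable_range fun t : Finset N => t.map (Function.Embedding.subtype _)).mono ?_
      intro s hs
      classical
      refine ⟨s.subtype (· ∈ N), ?_⟩
      ext x
      simpa using fun hx => hs hx
    have hle : Monotone fun n => step^[n] M :=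
      monotone_nat_of_le_succ fun n => by
        rw [Function.iterate_succ_apply']; exact subset_union_left
    have hcount (n : ℕ) : (step^[n] M).Countable := by
      induction n with
      | zero => exact hM
      | succ n ih => rw [Function.iterate_succ_apply']; exact hstep _ ih
    refine (countable_iUnion hcount).mono (sInter_subset_of_mem ⟨?_, fun s hs => ?_⟩)
    · exact subset_iUnion (fun n => step^[n] M) 0
    · obtain ⟨n, hn⟩ := hle.directed_le.exists_mem_subset_of_finset_subset_biUnion hs
      refine Subset.trans ?_ (subset_iUnion _ (n + 1))
      rw [Function.iterate_succ_apply']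
      exact fun x hx => Or.inr (mem_iUnion₂.2 ⟨s, hn, hx⟩)
  · refine sInter_subset_of_mem ⟨iUnion_mono fun i => hsub _, fun s hs => ?_⟩
    have hdir' : Directed (· ⊆ ·) fun i => ⋂₀ C (M i) := hdir.mono_comp (g := fun M => ⋂₀ C M) _ hmono
    obtain ⟨i, hi⟩ := hdir'.exists_mem_subset_of_finset_subset_biUnion hs
    exact (hclosed _ s hi).trans (subset_iUnion (fun i => ⋂₀ C (M i)) i)

theorem exists_countable_approx {P Q : Type*} (G : P → Q → ℝ) (s : Finset Q) :
    ∃ A : Set P, A.Countable ∧ ∀ p (ε : ℝ), 0 < ε → ∃ a ∈ A, ∀ q ∈ s, |G a q - G p q| < ε := by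
  let Φ : P → s → ℝ := fun p q => G p q
  obtain ⟨D, hDc, hD⟩ := TopologicalSpace.exists_countable_dense (range Φ)
  choose c hc using fun x : range Φ => x.2
  refine ⟨c '' D, hDc.image c, fun p ε hε => ?_⟩
  obtain ⟨x, hx, hdist⟩ := hD.exists_dist_lt ⟨Φ p, p, rfl⟩ hε
  refine ⟨c x, mem_image_of_mem c hx, fun q hq => ?_⟩
  have h1 : dist (Φ p ⟨q, hq⟩) (x.1 ⟨q, hq⟩) ≤ dist (Φ p) x.1 := dist_le_pi_dist _ _ _
  rw [← hc x, dist_comm, Real.dist_eq] at h1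
  refine h1.trans_lt ?_
  rw [hc x]
  exact hdist

theorem exists_mem_closure_forall_eq {P Q : Type*} [TopologicalSpace P] [CompactSpace P]
    {G : P → Q → ℝ} (hG : ∀ q, Continuous fun p => G p q) {A : Set P} {B : Set Q}
    (h : ∀ s : Finset Q, ↑s ⊆ B → ∀ p (ε : ℝ), 0 < ε → ∃ a ∈ A, ∀ q ∈ s, |G a q - G p q| < ε)
    (p : P) : ∃ p' ∈ closure A, ∀ q ∈ B, G p' q = G p q := by
  let Φ : P → B → ℝ := fun p q => G p q
  have hΦ : Continuous Φ := continuous_pi fun q => hG q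
  have hp : Φ p ∈ closure (Φ '' A) := by
    rw [mem_closure_pi_real_iff]
    intro t ε hε
    obtain ⟨a, ha, hap⟩ := h (t.map (Function.Embedding.subtype _)) (by simp) p ε hε
    exact ⟨Φ a, mem_image_of_mem Φ ha, fun q hq => hap q (Finset.mem_map_of_mem _ hq)⟩
  have hcl : closure (Φ '' A) ⊆ Φ '' closure A :=
    closure_minimal (image_mono subset_closure)
      (isClosed_closure.isCompact.image hΦ).isClosed
  obtain ⟨p', hp', heq⟩ := hcl hp
  exact ⟨p', hp', fun q hq => congrFun heq ⟨q, hq⟩⟩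

section Pairing

variable {K : Type u} {W : Type v} {F : K → W → ℝ}

/-- `N = A ⊕ B` is norming for `F` if `B` is dense in `W` and `A` is dense in `K`
for the topologies of pointwise convergence on `A` and on `B`. -/
structure IsNorming (F : K → W → ℝ) (N : Set (K ⊕ W)) : Prop where
  left : ∀ s : Finset K, ↑s ⊆ Sum.inl ⁻¹' N → ∀ w (ε : ℝ), 0 < ε →
    ∃ b ∈ Sum.inr ⁻¹' N, ∀ k ∈ s, |F k b - F k w| < ε
  right : ∀ s : Finset W, ↑s ⊆ Sum.inr ⁻¹' N → ∀ k (ε : ℝ), 0 < ε →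
    ∃ a ∈ Sum.inl ⁻¹' N, ∀ w ∈ s, |F a w - F k w| < ε

theorem exists_norming_hull (F : K → W → ℝ) :
    ∃ H : Set (K ⊕ W) → Set (K ⊕ W), (∀ M, M ⊆ H M) ∧ Monotone H ∧
      (∀ M, M.Countable → (H M).Countable) ∧ (∀ M, IsNorming F (H M)) ∧
      ∀ {κ : Type _} [Nonempty κ] (M : κ → Set (K ⊕ W)), Directed (· ⊆ ·) M →
        H (⋃ i, M i) ⊆ ⋃ i, H (M i) := by
  choose A hAc hA using exists_countable_approx F
  choose B hBc hB using exists_countable_approx fun w k => F k w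
  obtain ⟨H, hsub, hmono, hcount, hclosed, hfin⟩ := exists_finitary_hull
    (fun s : Finset (K ⊕ W) => Sum.inl '' A s.toRight ∪ Sum.inr '' B s.toLeft)
    fun s => ((hAc _).image _).union ((hBc _).image _)
  refine ⟨H, hsub, hmono, hcount, fun M => ⟨fun s hs w ε hε => ?_, fun s hs k ε hε => ?_⟩, hfin⟩
  · obtain ⟨b, hb, hbw⟩ := hB s w ε hε
    refine ⟨b, hclosed M (s.disjSum ∅) ?_ (Or.inr ⟨b, by rwa [Finset.toLeft_disjSum], rfl⟩), hbw⟩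
    intro x hx
    obtain ⟨k, hk, rfl⟩ : ∃ k ∈ s, Sum.inl k = x := by simpa [Finset.mem_disjSum] using hx
    exact hs hk
  · obtain ⟨a, ha, hak⟩ := hA s k ε hε
    refine ⟨a, hclosed M (Finset.disjSum ∅ s) ?_ (Or.inl ⟨a, by rwa [Finset.toRight_disjSum], rfl⟩), hak⟩
    intro x hx
    obtain ⟨w, hw, rfl⟩ : ∃ w ∈ s, Sum.inr w = x := by simpa [Finset.mem_disjSum] using hx
    exact hs hw

variable [TopologicalSpace K] [CompactSpace K] [TopologicalSpace W]

theorem IsNorming.eq_of_mem_closure (hK : ∀ w, Continuous fun k => F k w)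
    (hW : ∀ k, Continuous (F k)) (hsep : ∀ w w', (∀ k, F k w = F k w') → w = w')
    {N : Set (K ⊕ W)} (hN : IsNorming F N) {w w' : W} (hw : w ∈ closure (Sum.inr ⁻¹' N))
    (hw' : w' ∈ closure (Sum.inr ⁻¹' N)) (h : ∀ k, Sum.inl k ∈ N → F k w = F k w') : w = w' := by
  refine hsep w w' fun k => ?_
  obtain ⟨k', hk', heq⟩ := exists_mem_closure_forall_eq hK hN.right k
  have hcl : closure (Sum.inr ⁻¹' N) ⊆ {v | F k' v = F k v} :=
    closure_minimal heq (isClosed_eq (hW _) (hW _))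
  have hcl' : closure (Sum.inl ⁻¹' N) ⊆ {k | F k w = F k w'} :=
    closure_minimal h (isClosed_eq (hK _) (hK _))
  rw [← hcl hw, ← hcl hw']
  exact hcl' hk'

variable [CompactSpace W]

theorem IsNorming.exists_retraction (hK : ∀ w, Continuous fun k => F k w)
    (hW : ∀ k, Continuous (F k)) (hsep : ∀ w w', (∀ k, F k w = F k w') → w = w')
    {N : Set (K ⊕ W)} (hN : IsNorming F N) :
    ∃ r : W → W, Continuous r ∧ (∀ w, r w ∈ closure (Sum.inr ⁻¹' N)) ∧
      ∀ w k, Sum.inl k ∈ N → F k (r w) = F k w := by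
  choose r hr hrF using exists_mem_closure_forall_eq (G := fun w k => F k w) hW hN.left
  refine ⟨r, ?_, hr, hrF⟩
  let Φ : closure (Sum.inr ⁻¹' N) → (Sum.inl ⁻¹' N : Set K) → ℝ := fun w k => F k w
  have : CompactSpace (closure (Sum.inr ⁻¹' N)) :=
    isCompact_iff_compactSpace.1 isClosed_closure.isCompact
  have hΦ : IsClosedEmbedding Φ :=
    Continuous.isClosedEmbedding
      (continuous_pi fun k => (hW k).comp continuous_subtype_val) fun w w' h =>
        Subtype.ext (hN.eq_of_mem_closure hK hW hsep w.2 w'.2 fun k hk => congrFun h ⟨k, hk⟩)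
  have hr' : Continuous fun w => (⟨r w, hr w⟩ : closure (Sum.inr ⁻¹' N)) := by
    rw [hΦ.isInducing.continuous_iff]
    refine continuous_pi fun k => ?_
    have : (fun w => F k (r w)) = F k := funext fun w => hrF w k k.2
    exact (congrArg Continuous this).mpr (hW k)
  exact continuous_subtype_val.comp hr'

/-- Compact subspaces of `C_p(K)` are countably tight. -/
theorem exists_countable_mem_closure (hK : ∀ w, Continuous fun k => F k w)
    (hW : ∀ k, Continuous (F k)) (hsep : ∀ w w', (∀ k, F k w = F k w') → w = w')
    {B : Set W} {w : W} (hw : w ∈ closure B) : ∃ T ⊆ B, T.Countable ∧ w ∈ closure T := by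
  have hΦ : IsClosedEmbedding fun (w : W) (k : K) => F k w :=
    (continuous_pi hW).isClosedEmbedding fun w w' h => hsep w w' (congrFun h)
  rw [hΦ.isInducing.closure_eq_preimage_closure_image, mem_preimage, mem_closure_pi_real_iff] at hw
  have key (n m : ℕ) : ∃ T : Set W, T.Countable ∧ T ⊆ B ∧
      ∀ k : Fin n → K, ∃ b ∈ T, ∀ i, |F (k i) b - F (k i) w| < 1 / ((m : ℝ) + 1) := by
    classical
    have (k : Fin n → K) : ∃ b ∈ B, ∀ i, |F (k i) b - F (k i) w| < 1 / ((m : ℝ) + 1) := by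
      obtain ⟨-, ⟨b, hb, rfl⟩, hbw⟩ := hw (Finset.univ.image k) (1 / ((m : ℝ) + 1)) (by positivity)
      exact ⟨b, hb, fun i => hbw _ (by simp)⟩
    choose b hb hbw using this
    let U : (Fin n → K) → Set (Fin n → K) := fun k =>
      {k' | ∀ i, |F (k' i) (b k) - F (k' i) w| < 1 / ((m : ℝ) + 1)}
    have hU (k) : U k ∈ 𝓝 k := by
      have : IsOpen (U k) := by
        simp only [U, ofPred_forall]
        refine isOpen_iInter_of_finite fun i => isOpen_lt ?_ continuous_const
        exact (((hK _).comp (continuous_apply i)).sub ((hK _).comp (continuous_apply i))).abs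
      exact this.mem_nhds (hbw k)
    obtain ⟨t, ht⟩ := CompactSpace.elim_nhds_subcover U hU
    refine ⟨b '' t, (t.finite_toSet.image b).countable, by rintro - ⟨k, -, rfl⟩; exact hb k,
      fun k => ?_⟩
    have hk : k ∈ ⋃ x ∈ t, U x := ht ▸ mem_univ k
    obtain ⟨x, hx, hkx⟩ := mem_iUnion₂.1 hk
    exact ⟨b x, mem_image_of_mem b hx, hkx⟩
  choose T hTc hTB hT using key
  refine ⟨⋃ n, ⋃ m, T n m, iUnion_subset fun n => iUnion_subset fun m => hTB n m,
    countable_iUnion fun n => countable_iUnion fun m => hTc n m, ?_⟩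
  rw [hΦ.isInducing.closure_eq_preimage_closure_image, mem_preimage, mem_closure_pi_real_iff]
  intro t ε hε
  obtain ⟨m, hm⟩ := exists_nat_one_div_lt hε
  obtain ⟨b, hb, hbw⟩ := hT t.card m fun i => t.equivFin.symm i
  refine ⟨_, ⟨b, mem_iUnion₂.2 ⟨_, _, hb⟩, rfl⟩, fun k hk => ?_⟩
  simpa using (hbw (t.equivFin ⟨k, hk⟩)).trans hm

theorem exists_uncountable_countable_initial_segments {ι : Type*} [LinearOrder ι]
    [WellFoundedLT ι] {C : Set ι} (hC : ¬C.Countable) :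
    ∃ I ⊆ C, ¬I.Countable ∧ ∀ i ∈ I, (I ∩ Iio i).Countable := by
  by_cases h : ∀ i ∈ C, (C ∩ Iio i).Countable
  · exact ⟨C, Subset.rfl, hC, h⟩
  push Not at h
  obtain ⟨i, ⟨hiC, hi⟩, hmin⟩ :=
    wellFounded_lt.has_min {i | i ∈ C ∧ ¬(C ∩ Iio i).Countable} h
  refine ⟨C ∩ Iio i, inter_subset_left, hi, fun j hj => ?_⟩
  by_contra hj'
  exact hmin j ⟨hj.1, fun hc => hj' (hc.mono (by grind))⟩ hj.2

/-- Along a continuous chain of norming sets, the associated retractions move a given point only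
countably many times. -/
theorem countable_setOf_retraction_ne (hK : ∀ w, Continuous fun k => F k w)
    (hW : ∀ k, Continuous (F k)) (hsep : ∀ w w', (∀ k, F k w = F k w') → w = w')
    {ι : Type*} [LinearOrder ι] [WellFoundedLT ι] {N : Set ι → Set (K ⊕ W)} (hmono : Monotone N)
    (hnorm : ∀ J, IsNorming F (N J))
    (hfin : ∀ J, IsLowerSet J → N J ⊆ N ∅ ∪ ⋃ j ∈ J, N (Iic j)) {r r' : ι → W → W}
    (hr : ∀ i w, r i w ∈ closure (Sum.inr ⁻¹' N (Iio i)))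
    (hrF : ∀ i w k, Sum.inl k ∈ N (Iio i) → F k (r i w) = F k w)
    (hr' : ∀ i w, r' i w ∈ closure (Sum.inr ⁻¹' N (Iic i)))
    (hrF' : ∀ i w k, Sum.inl k ∈ N (Iic i) → F k (r' i w) = F k w) (w : W) :
    {i | r' i w ≠ r i w}.Countable := by
  by_contra hC
  obtain ⟨I, hIC, hI, hseg⟩ := exists_uncountable_countable_initial_segments hC
  have hIne : I.Nonempty := by
    by_contra h
    exact hI (by simp [not_nonempty_iff_eq_empty.1 h])
  let J : Set ι := {x | ∃ i ∈ I, x < i}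
  have hJ : IsLowerSet J := fun x y hyx ⟨i, hi, hxi⟩ => ⟨i, hi, hyx.trans_lt hxi⟩
  obtain ⟨q, hq, hqF⟩ := exists_mem_closure_forall_eq (G := fun w k => F k w) hW (hnorm J).left w
  obtain ⟨T, hTJ, hTc, hqT⟩ := exists_countable_mem_closure hK hW hsep hq
  have hstage : ∀ t ∈ T, ∃ i ∈ I, Sum.inr t ∈ N (Iio i) := by
    intro t ht
    rcases hfin J hJ (hTJ ht) with h | h
    · obtain ⟨i, hi⟩ := hIne
      exact ⟨i, hi, hmono (empty_subset _) h⟩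
    · obtain ⟨j, ⟨i, hi, hji⟩, htj⟩ := mem_iUnion₂.1 h
      exact ⟨i, hi, hmono (Iic_subset_Iio.2 hji) htj⟩
  have : Nonempty ι := ⟨hIne.some⟩
  choose! α hα hTα using hstage
  obtain ⟨i, hiI, hi⟩ : ∃ i ∈ I, ∀ t ∈ T, α t ≤ i := by
    by_contra! h
    refine hI ((hTc.biUnion fun t ht => hseg (α t) (hα t ht)).mono fun i hi => ?_)
    obtain ⟨t, ht, hlt⟩ := h i hi
    exact mem_iUnion₂.2 ⟨t, ht, hi, hlt⟩
  obtain ⟨i', hi'I, hii'⟩ : ∃ i' ∈ I, i < i' := by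
    by_contra! h
    exact hI (((hseg i hiI).insert i).mono fun x hx => by
      rcases (h x hx).eq_or_lt with h | h
      · exact Or.inl h
      · exact Or.inr ⟨hx, h⟩)
  have hqi : q ∈ closure (Sum.inr ⁻¹' N (Iio i)) :=
    closure_mono (fun t ht => hmono (Iio_subset_Iio (hi t ht)) (hTα t ht)) hqT
  have hqi' : q ∈ closure (Sum.inr ⁻¹' N (Iic i)) :=
    closure_mono (preimage_mono (hmono Iio_subset_Iic_self)) hqi
  have hsubJ : Iic i ⊆ J := fun x hx => ⟨i', hi'I, lt_of_le_of_lt hx hii'⟩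
  have h1 : r i w = q := (hnorm _).eq_of_mem_closure hK hW hsep (hr i w) hqi fun k hk => by
    rw [hrF i w k hk, hqF k (hmono (Iio_subset_Iic_self.trans hsubJ) hk)]
  have h2 : r' i w = q := (hnorm _).eq_of_mem_closure hK hW hsep (hr' i w) hqi' fun k hk => by
    rw [hrF' i w k hk, hqF k (hmono hsubJ hk)]
  exact hIC hiI (h2.trans h1.symm)

end Pairing

section Corson

variable {K W : Type u} [TopologicalSpace W] {F : K → W → ℝ}

/-- There is a point-countable family of continuous functions on `W` which distinguishes all
points that are distinguished by `F k` for some `k ∈ A`. -/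
def HasPointCountableFamily (F : K → W → ℝ) (A : Set K) : Prop :=
  ∃ (S : Type u) (f : S → W → ℝ), (∀ s, Continuous (f s)) ∧ (∀ w, {s | f s w ≠ 0}.Countable) ∧
    ∀ w w', (∀ s, f s w = f s w') → ∀ k ∈ A, F k w = F k w'

theorem HasPointCountableFamily.of_countable (hW : ∀ k, Continuous (F k)) {A : Set K}
    (hA : A.Countable) : HasPointCountableFamily F A := by
  have := hA.to_subtype
  exact ⟨A, fun k => F k, fun k => hW k, fun w => to_countable _, fun w w' h k hk => h ⟨k, hk⟩⟩

variable [TopologicalSpace K] [CompactSpace K] [CompactSpace W]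

theorem HasPointCountableFamily.of_chain (hK : ∀ w, Continuous fun k => F k w)
    (hW : ∀ k, Continuous (F k)) (hsep : ∀ w w', (∀ k, F k w = F k w') → w = w')
    {ι : Type u} [LinearOrder ι] [WellFoundedLT ι] {N : Set ι → Set (K ⊕ W)} (hmono : Monotone N)
    (hnorm : ∀ J, IsNorming F (N J))
    (hfin : ∀ J, IsLowerSet J → N J ⊆ N ∅ ∪ ⋃ j ∈ J, N (Iic j))
    (hbot : HasPointCountableFamily F (Sum.inl ⁻¹' N ∅))
    (hIic : ∀ i, HasPointCountableFamily F (Sum.inl ⁻¹' N (Iic i))) :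
    HasPointCountableFamily F (Sum.inl ⁻¹' N univ) := by
  choose r hrc hr hrF using fun i => (hnorm (Iio i)).exists_retraction hK hW hsep
  choose r' hrc' hr' hrF' using fun i => (hnorm (Iic i)).exists_retraction hK hW hsep
  obtain ⟨S₀, f₀, hf₀c, hf₀, hf₀sep⟩ := hbot
  choose S f hfc hf hfsep using hIic
  have hlower (J : Set ι) (hJ : IsLowerSet J) (w w' : W) (h₀ : ∀ s, f₀ s w = f₀ s w')
      (h : ∀ j ∈ J, ∀ k, Sum.inl k ∈ N (Iic j) → F k w = F k w') (k : K)
      (hk : Sum.inl k ∈ N J) : F k w = F k w' := by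
    rcases hfin J hJ hk with hk | hk
    · exact hf₀sep w w' h₀ k hk
    · obtain ⟨j, hj, hkj⟩ := mem_iUnion₂.1 hk
      exact h j hj k hkj
  refine ⟨S₀ ⊕ Σ i, S i, Sum.elim f₀ fun s w => f s.1 s.2 (r' s.1 w) - f s.1 s.2 (r s.1 w),
    ?_, fun w => ?_, fun w w' h => ?_⟩
  · rintro (s | ⟨i, s⟩)
    · exact hf₀c s
    · exact ((hfc i s).comp (hrc' i)).sub ((hfc i s).comp (hrc i))
  · have hmoved := countable_setOf_retraction_ne hK hW hsep hmono hnorm hfin hr hrF hr' hrF' w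
    refine (((hf₀ w).image Sum.inl).union ((hmoved.biUnion fun i _ =>
      ((hf i (r' i w)).union (hf i (r i w))).image (Sigma.mk i)).image Sum.inr)).mono ?_
    rintro (s | ⟨i, s⟩) hs
    · exact Or.inl ⟨s, hs, rfl⟩
    · refine Or.inr ⟨⟨i, s⟩, mem_iUnion₂.2 ⟨i, fun h => hs (by simp [h]), s, ?_, rfl⟩, rfl⟩
      by_contra hzero
      simp only [mem_union, mem_ofPred_eq, not_or, not_not] at hzero
      exact hs (by simp [hzero.1, hzero.2])
  · have h₀ (s) : f₀ s w = f₀ s w' := h (Sum.inl s)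
    refine hlower univ isLowerSet_univ w w' h₀ fun i _ => ?_
    induction i using WellFoundedLT.induction with
    | ind i ih =>
      have hri : r i w = r i w' :=
        (hnorm _).eq_of_mem_closure hK hW hsep (hr i w) (hr i w') fun k hk => by
          rw [hrF i w k hk, hrF i w' k hk]
          exact hlower (Iio i) (isLowerSet_Iio i) w w' h₀ (fun j hj => ih j hj (mem_univ j)) k hk
      intro k hk
      rw [← hrF' i w k hk, ← hrF' i w' k hk]
      refine hfsep i _ _ (fun s => ?_) k hk
      have hs : f i s (r' i w) - f i s (r i w) = f i s (r' i w') - f i s (r i w') :=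
        h (Sum.inr ⟨i, s⟩)
      rw [hri] at hs
      exact sub_left_injective hs

theorem hasPointCountableFamily_univ (hK : ∀ w, Continuous fun k => F k w)
    (hW : ∀ k, Continuous (F k)) (hsep : ∀ w w', (∀ k, F k w = F k w') → w = w') :
    HasPointCountableFamily F univ := by
  obtain ⟨H, hsub, hmono, hcount, hnorm, hfin⟩ := exists_norming_hull.{u, u, u} F
  have hctbl (M : Set (K ⊕ W)) (hM : M.Countable) :
      HasPointCountableFamily F (Sum.inl ⁻¹' H M) :=
    .of_countable hW ((hcount M hM).preimage Sum.inl_injective)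
  have key (c : Cardinal.{u}) : ∀ M : Set (K ⊕ W), Cardinal.mk M = c →
      HasPointCountableFamily F (Sum.inl ⁻¹' H M) := by
    induction c using WellFoundedLT.induction with
    | ind c ih =>
      intro M hMc
      rcases le_or_gt c Cardinal.aleph0 with hc | hc
      · exact hctbl M (Cardinal.le_aleph0_iff_set_countable.1 (hMc.trans_le hc))
      obtain ⟨e⟩ : Nonempty (c.ord.ToType ≃ M) := Cardinal.eq.1 (by simp [hMc])
      let N : Set c.ord.ToType → Set (K ⊕ W) := fun J => H ((fun i => (e i : K ⊕ W)) '' J)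
      have hN : N univ = H M := by
        refine congrArg H (Subset.antisymm ?_ fun x hx => ⟨e.symm ⟨x, hx⟩, mem_univ _, by simp⟩)
        rintro - ⟨i, -, rfl⟩
        exact (e i).2
      rw [← hN]
      refine .of_chain hK hW hsep (fun J J' h => hmono (image_mono h)) (fun J => hnorm _)
        (fun J hJ => ?_) (hctbl _ (by simp)) fun i => ih _ ?_ _ rfl
      · rcases J.eq_empty_or_nonempty with rfl | hne
        · exact subset_union_left
        have := hne.to_subtype
        have hJ' : J = ⋃ j : J, Iic j.1 := by
          ext x
          simp only [mem_iUnion, mem_Iic]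
          exact ⟨fun hx => ⟨⟨x, hx⟩, le_rfl⟩, fun ⟨j, hj⟩ => hJ hj j.2⟩
        refine Subset.trans ?_ subset_union_right
        rw [biUnion_eq_iUnion]
        refine Subset.trans (hmono ?_) (hfin (fun j : J => (fun i => (e i : K ⊕ W)) '' Iic j.1) ?_)
        · rw [← image_iUnion, ← hJ']
        · exact Monotone.directed_le fun j j' h => image_mono (Iic_subset_Iic.2 h)
      · refine Cardinal.mk_image_le.trans_lt ?_
        rw [← Iio_insert]
        exact Cardinal.mk_insert_le.trans_lt (Cardinal.add_lt_of_lt hc.le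
          ((Cardinal.mk_Iio_lt i (by simp)).trans_eq (by simp)) (Cardinal.one_lt_aleph0.trans hc))
  obtain ⟨S, f, hfc, hf, hfsep⟩ := key _ univ rfl
  exact ⟨S, f, hfc, hf, fun w w' h k _ => hfsep w w' h k (hsub _ (mem_univ _))⟩

end Corson

/-- The Amir–Lindenstrauss theorem for compact spaces: Eberlein compacta are Corson. -/
theorem IsEberleinCompact.isCorsonCompact {L : Type u} [TopologicalSpace L]
    (hL : IsEberleinCompact.{u, u} L) : IsCorsonCompact.{u, u} L := by
  obtain ⟨hLc, K, _, _, W, hWc, -, ⟨e⟩⟩ := hL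
  obtain ⟨S, f, hfc, hf, hfsep⟩ := hasPointCountableFamily_univ
    (F := fun (k : K) (x : L) => (e x).1 k) (fun x => hWc _ (e x).2)
    (fun k => (continuous_apply k).comp (continuous_subtype_val.comp e.continuous))
    fun x x' h => e.injective (Subtype.ext (funext h))
  have hinj : Function.Injective fun x s => f s x := fun x x' h =>
    e.injective (Subtype.ext (funext fun k => hfsep x x' (congrFun h) k (mem_univ k)))
  have hemb := (continuous_pi hfc).isClosedEmbedding hinj
  exact ⟨hLc, S, range fun x s => f s x, isCompact_range (continuous_pi hfc),
    by rintro - ⟨x, rfl⟩; exact hf x, ⟨hemb.isEmbedding.toHomeomorph⟩⟩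

/-- Proposition 4.2 (first part): for a bounded set `E ⊆ X` and a compact
`Y ⊆ C_p(X)`, the image of `Y` under the restriction map `y ↦ y|_E` is an
Eberlein compact, in particular a Corson compact. -/
theorem stmt11 {X : Type u} [TopologicalSpace X] (E : Set X)
    (hE : ∀ g : X → ℝ, Continuous g → Bornology.IsBounded (g '' E))
    (Y : Set (X → ℝ)) (hYc : ∀ y ∈ Y, Continuous y) (hY : IsCompact Y) :
    IsEberleinCompact.{u, u} ((fun (y : X → ℝ) (e : E) => y e) '' Y) ∧
    IsCorsonCompact.{u, u} ((fun (y : X → ℝ) (e : E) => y e) '' Y) := by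
  have h := isEberleinCompact_image_restrict E hE Y hYc hY
  exact ⟨h, h.isCorsonCompact⟩
end

section
/- Let X be a topological space that is β-unfavorable in the Choquet game, and let 𝒫 be a system of subsets of X closed under finite unions such that: for every E ∈ 𝒫 and every compact Y ⊆ C_p(X), the image of Y under the restriction map C_p(X) → C_p(E) is a Valdivia compact. If β has no winning strategy in the G_𝒫-game on X, then X is a Namioka space: for every compact space K and every separately continuous function f : X × K → ℝ there exists a dense G_δ set A ⊆ X such that f is jointly continuous at every point of A × K. -/
universe u v

section Game

variable {X : Type u} [TopologicalSpace X]

/-- In the `G_𝒫`-game, a play is recorded by `α`'s moves `m : ℕ → Set X × Set X`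
(at stage `n`, `α` plays the open set `(m n).1 = Vₙ₊₁` and the set
`(m n).2 = Pₙ₊₁ ∈ 𝒫`), while `β`'s moves are given by a strategy
`σ : ℕ → (ℕ → Set X × Set X) → Set X` (so `Uₙ = σ n m`).
`α`'s `n`-th move is legal if it is a nonempty open subset of `β`'s previous
move `σ n m` and its second component belongs to `𝒫`. -/
def AlphaLegal (P : Set (Set X)) (σ : ℕ → (ℕ → Set X × Set X) → Set X)
    (m : ℕ → Set X × Set X) (n : ℕ) : Prop :=
  IsOpen (m n).1 ∧ (m n).1.Nonempty ∧ (m n).1 ⊆ σ n m ∧ (m n).2 ∈ P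

/-- `σ` is a winning strategy for `β` in the `G_𝒫`-game: it depends only on
`α`'s previous moves, its moves are legal (nonempty open, and contained in
`α`'s preceding move) as long as `α` has played legally, and in every play in
which `α` plays legally we have `(⋂ₙ Vₙ) ∩ (⋃ₙ Pₙ) = ∅`, i.e. `β` wins. -/
def BetaWinning (P : Set (Set X)) (σ : ℕ → (ℕ → Set X × Set X) → Set X) : Prop :=
  (∀ n, ∀ m m' : ℕ → Set X × Set X, (∀ k < n, m k = m' k) → σ n m = σ n m') ∧
  (∀ m : ℕ → Set X × Set X, IsOpen (σ 0 m) ∧ (σ 0 m).Nonempty) ∧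
  (∀ m : ℕ → Set X × Set X, ∀ n, (∀ k ≤ n, AlphaLegal P σ m k) →
    IsOpen (σ (n + 1) m) ∧ (σ (n + 1) m).Nonempty ∧ σ (n + 1) m ⊆ (m n).1) ∧
  (∀ m : ℕ → Set X × Set X, (∀ n, AlphaLegal P σ m n) →
    (⋂ n, (m n).1) ∩ (⋃ n, (m n).2) = ∅)

end Game

/-- A Valdivia compact: a compact space homeomorphic to a compact `Z ⊆ ℝ^S`
in which the points of countable support are dense. -/
def IsValdiviaCompact (K : Type u) [TopologicalSpace K] : Prop :=
  CompactSpace K ∧ ∃ (S : Type v) (Z : Set (S → ℝ)), IsCompact Z ∧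
    Dense {z : Z | {s : S | (z : S → ℝ) s ≠ 0}.Countable} ∧ Nonempty (K ≃ₜ Z)

open Topology Filter

/-- A positional description of a winning strategy for `β`: the states `s : St` carry `β`'s
current move `O s`, and `R s p s'` says that `s'` is an admissible successor of `s` after
`α` has played `p`. -/
theorem exists_betaWinning_of_states {X : Type u} [TopologicalSpace X] {P : Set (Set X)}
    {St : Type v} (O : St → Set X) (I : St → Prop) (R : St → Set X × Set X → St → Prop)
    (s₀ : St) (h₀ : I s₀) (hI : ∀ s, I s → IsOpen (O s) ∧ (O s).Nonempty)
    (hstep : ∀ s V Q, I s → IsOpen V → V.Nonempty → V ⊆ O s → Q ∈ P →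
      ∃ s', R s (V, Q) s' ∧ I s' ∧ O s' ⊆ V)
    (hwin : ∀ (m : ℕ → Set X × Set X) (s : ℕ → St), s 0 = s₀ →
      (∀ n, R (s n) (m n) (s (n + 1))) → (∀ n, I (s n)) → (∀ n, (m n).1 ⊆ O (s n)) →
      ∀ x, (∀ n, x ∈ (m n).1) → ∀ n, x ∉ (m n).2) :
    ∃ σ, BetaWinning P σ := by
  classical
  have hex : ∀ (s : St) (p : Set X × Set X), ∃ s',
      (I s → IsOpen p.1 → p.1.Nonempty → p.1 ⊆ O s → p.2 ∈ P →
        R s p s' ∧ I s' ∧ O s' ⊆ p.1) := by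
    intro s p
    by_cases h : I s ∧ IsOpen p.1 ∧ p.1.Nonempty ∧ p.1 ⊆ O s ∧ p.2 ∈ P
    · obtain ⟨s', hs'⟩ := hstep s p.1 p.2 h.1 h.2.1 h.2.2.1 h.2.2.2.1 h.2.2.2.2
      exact ⟨s', fun _ _ _ _ _ => hs'⟩
    · exact ⟨s, fun a b c d e => absurd ⟨a, b, c, d, e⟩ h⟩
  choose next hnext using hex
  let state : (ℕ → Set X × Set X) → ℕ → St := fun m n =>
    Nat.rec s₀ (fun k s => next s (m k)) n
  have hsucc : ∀ m n, state m (n + 1) = next (state m n) (m n) := fun _ _ => rfl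
  have hinv : ∀ m n, (∀ k < n, AlphaLegal P (fun n m => O (state m n)) m k) →
      I (state m n) := by
    intro m n
    induction n with
    | zero => exact fun _ => h₀
    | succ n ih =>
      intro h
      obtain ⟨a, b, c, d⟩ := h n (Nat.lt_succ_self n)
      exact (hnext _ _ (ih fun k hk => h k (hk.trans (Nat.lt_succ_self n))) a b c d).2.1
  refine ⟨fun n m => O (state m n), ?_, fun m => hI _ h₀, ?_, ?_⟩
  · intro n m m' h
    have : state m n = state m' n := by
      induction n with
      | zero => rfl
      | succ n ih =>
        rw [hsucc, hsucc, ih fun k hk => h k (hk.trans (Nat.lt_succ_self n)),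
          h n (Nat.lt_succ_self n)]
    simp only [this]
  · intro m n h
    have hn := hinv m n fun k hk => h k hk.le
    have hn' := hinv m (n + 1) fun k hk => h k (Nat.lt_succ_iff.1 hk)
    obtain ⟨a, b, c, d⟩ := h n le_rfl
    exact ⟨(hI _ hn').1, (hI _ hn').2, (hnext _ _ hn a b c d).2.2⟩
  · intro m h
    have hs : ∀ n, I (state m n) := fun n => hinv m n fun k _ => h k
    refine Set.eq_empty_of_forall_notMem ?_
    rintro x ⟨hx, hx'⟩
    obtain ⟨n, hn⟩ := Set.mem_iUnion.1 hx'
    refine hwin m (state m) rfl (fun n => ?_) hs (fun n => (h n).2.2.1) x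
      (Set.mem_iInter.1 hx) n hn
    obtain ⟨a, b, c, d⟩ := h n
    exact (hnext _ _ (hs n) a b c d).1

/-- A space in which `β` has no winning strategy in the Choquet game is a Baire space. -/
theorem baireSpace_of_not_betaWinning {X : Type u} [TopologicalSpace X]
    (h : ¬ ∃ σ, BetaWinning ({Set.univ} : Set (Set X)) σ) : BaireSpace X := by
  refine ⟨fun G hGo hGd => ?_⟩
  by_contra hd
  rw [dense_iff_inter_open] at hd
  push Not at hd
  obtain ⟨U, hU, hUne, hUG⟩ := hd
  refine h (exists_betaWinning_of_states (St := ℕ × Set X) Prod.snd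
    (fun s => IsOpen s.2 ∧ s.2.Nonempty ∧ s.2 ⊆ U)
    (fun s p s' => s'.1 = s.1 + 1 ∧ s'.2 ⊆ G s.1) (0, U) ⟨hU, hUne, subset_rfl⟩
    (fun s hs => ⟨hs.1, hs.2.1⟩) ?_ ?_)
  · rintro ⟨n, W⟩ V Q ⟨-, -, hWU⟩ hV hVne hVW -
    exact ⟨(n + 1, V ∩ G n), ⟨rfl, Set.inter_subset_right⟩,
      ⟨hV.inter (hGo n), (hGd n).inter_open_nonempty V hV hVne,
        Set.inter_subset_left.trans (hVW.trans hWU)⟩, Set.inter_subset_left⟩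
  · intro m s hs₀ hR hI hm x hx _ _
    have hn : ∀ n, (s n).1 = n := by
      intro n
      induction n with
      | zero => rw [hs₀]
      | succ n ih => rw [(hR n).1, ih]
    have : x ∈ U ∩ ⋂ n, G n := by
      refine ⟨(hI 0).2.2 (hm 0 (hx 0)), Set.mem_iInter.2 fun n => ?_⟩
      have := (hR n).2 (hm (n + 1) (hx (n + 1)))
      rwa [hn n] at this
    rw [hUG] at this
    exact this

/-- A countable set is covered by an increasing sequence of finite sets. -/
theorem Set.Countable.exists_monotone_finset {S : Type u} {A : Set S} (hA : A.Countable) :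
    ∃ e : ℕ → Finset S, Monotone e ∧ ∀ s ∈ A, ∃ n, s ∈ e n := by
  obtain ⟨c, hc⟩ := Set.countable_iff_exists_injOn.1 hA
  have hfin : ∀ n, {s | s ∈ A ∧ c s ≤ n}.Finite := fun n =>
    Set.Finite.of_finite_image ((Set.finite_Iic n).subset (by rintro _ ⟨s, hs, rfl⟩; exact hs.2))
      (hc.mono fun s hs => hs.1)
  refine ⟨fun n => (hfin n).toFinset, fun a b hab s hs => ?_, fun s hs => ⟨c s, by simpa using hs⟩⟩
  simp only [Set.Finite.mem_toFinset, Set.mem_ofPred_eq] at hs ⊢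
  exact ⟨hs.1, hs.2.trans hab⟩

/-- If `g` oscillates by more than `ε` on every nonempty open subset of `W`, then the
oscillation is witnessed by points of a dense set which are close in finitely many
coordinates. -/
theorem exists_close_pair_of_oscillation {X : Type u} [TopologicalSpace X] {S : Type v}
    {Z : Set (S → ℝ)} (hZ : IsCompact Z) {D : Set Z} (hD : Dense D) (g : X → Z → ℝ)
    (hg₁ : ∀ z, Continuous fun x => g x z) {W : Set X} (hW : IsOpen W) (hWne : W.Nonempty)
    (hg₂ : ∀ x ∈ W, Continuous (g x)) {ε : ℝ} (hε : 0 < ε)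
    (hosc : ∀ W' ⊆ W, IsOpen W' → W'.Nonempty → ∃ x ∈ W', ∃ x' ∈ W', ∃ z, ε < |g x z - g x' z|)
    (F : Finset S) {δ : ℝ} (hδ : 0 < δ) :
    ∃ y ∈ D, ∃ y' ∈ D, (∀ s ∈ F, |(y : S → ℝ) s - (y' : S → ℝ) s| < δ) ∧
      ∃ W' ⊆ W, IsOpen W' ∧ W'.Nonempty ∧ ∀ x ∈ W', ε / 8 < |g x y - g x y'| := by
  have : CompactSpace Z := isCompact_iff_compactSpace.1 hZ
  by_contra hcon
  have hcont : ∀ s : S, Continuous fun z : Z => (z : S → ℝ) s := fun s =>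
    (continuous_apply s).comp continuous_subtype_val
  have hclose : ∀ x ∈ W, ∀ y ∈ D, ∀ y' ∈ D,
      (∀ s ∈ F, |(y : S → ℝ) s - (y' : S → ℝ) s| < δ) → |g x y - g x y'| ≤ ε / 8 := by
    intro x hx y hy y' hy' hs
    by_contra hlt
    refine hcon ⟨y, hy, y', hy', hs, W ∩ {x | ε / 8 < |g x y - g x y'|}, Set.inter_subset_left,
      hW.inter (isOpen_lt continuous_const ((hg₁ y).sub (hg₁ y')).abs), ⟨x, hx, not_le.1 hlt⟩,
      fun x hx => hx.2⟩
  have hopen : IsOpen {p : Z × Z | ∀ s ∈ F, |(p.1 : S → ℝ) s - (p.2 : S → ℝ) s| < δ} := by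
    have : {p : Z × Z | ∀ s ∈ F, |(p.1 : S → ℝ) s - (p.2 : S → ℝ) s| < δ} =
        ⋂ s ∈ F, {p : Z × Z | |(p.1 : S → ℝ) s - (p.2 : S → ℝ) s| < δ} := by
      ext; simp
    rw [this]
    exact isOpen_biInter_finset fun s _ =>
      isOpen_lt (((hcont s).comp continuous_fst).sub ((hcont s).comp continuous_snd)).abs
        continuous_const
  have hclose' : ∀ x ∈ W, ∀ y y' : Z,
      (∀ s ∈ F, |(y : S → ℝ) s - (y' : S → ℝ) s| < δ) → |g x y - g x y'| ≤ ε / 8 := by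
    intro x hx y y' hs
    have hcl : IsClosed {p : Z × Z | |g x p.1 - g x p.2| ≤ ε / 8} :=
      isClosed_le (((hg₂ x hx).comp continuous_fst).sub
        ((hg₂ x hx).comp continuous_snd)).abs continuous_const
    have := (hD.prod hD).open_subset_closure_inter hopen (show (y, y') ∈ _ from hs)
    refine closure_minimal ?_ hcl this
    rintro ⟨p, q⟩ ⟨hpq, hp, hq⟩
    exact hclose x hx p hp q hq hpq
  obtain ⟨t, ht⟩ := CompactSpace.elim_nhds_subcover
    (fun z : Z => {y : Z | ∀ s ∈ F, |(y : S → ℝ) s - (z : S → ℝ) s| < δ}) fun z =>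
      (hopen.preimage (Continuous.prodMk_left z)).mem_nhds (by simp [hδ])
  obtain ⟨x₀, hx₀⟩ := hWne
  have hW' : IsOpen (W ∩ ⋂ z ∈ t, {x | |g x z - g x₀ z| < ε / 8}) :=
    hW.inter (isOpen_biInter_finset fun z _ =>
      isOpen_lt ((hg₁ z).sub continuous_const).abs continuous_const)
  have hbound : ∀ x ∈ W ∩ ⋂ z ∈ t, {x | |g x z - g x₀ z| < ε / 8}, ∀ y,
      |g x y - g x₀ y| ≤ 3 * ε / 8 := by
    rintro x ⟨hx, hxt⟩ y
    have hy : y ∈ ⋃ z ∈ t, {y : Z | ∀ s ∈ F, |(y : S → ℝ) s - (z : S → ℝ) s| < δ} := by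
      rw [ht]; trivial
    simp only [Set.mem_iUnion, exists_prop] at hy
    obtain ⟨z, hzt, hyz⟩ := hy
    have h₁ := abs_le.1 (hclose' x hx y z hyz)
    have h₂ := abs_le.1 (hclose' x₀ hx₀ y z hyz)
    have h₃ : |g x z - g x₀ z| < ε / 8 := Set.mem_iInter₂.1 hxt z hzt
    have h₃ := abs_lt.1 h₃
    exact abs_le.2 ⟨by linarith [h₁.1, h₂.2, h₃.1], by linarith [h₁.2, h₂.1, h₃.2]⟩
  obtain ⟨x, hx, x', hx', z, hz⟩ := hosc _ Set.inter_subset_left hW'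
    ⟨x₀, hx₀, by simp [hε]⟩
  have h₁ := abs_le.1 (hbound x hx z)
  have h₂ := abs_le.1 (hbound x' hx' z)
  rw [lt_abs] at hz
  rcases hz with hz | hz <;> linarith [h₁.1, h₁.2, h₂.1, h₂.2]

/-- Valdivia compacta have the Namioka property with respect to spaces in which `β` has no
winning strategy in the Choquet game. -/
theorem exists_small_oscillation_of_valdivia {X : Type u} [TopologicalSpace X]
    (hX : ¬ ∃ σ, BetaWinning ({Set.univ} : Set (Set X)) σ) {S : Type v}
    {Z : Set (S → ℝ)} (hZ : IsCompact Z)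
    (hD : Dense {z : Z | {s : S | (z : S → ℝ) s ≠ 0}.Countable}) (g : X → Z → ℝ)
    (hg₁ : ∀ z, Continuous fun x => g x z) {U : Set X} (hU : IsOpen U) (hUne : U.Nonempty)
    (hg₂ : ∀ x ∈ U, Continuous (g x)) {ε : ℝ} (hε : 0 < ε) :
    ∃ W ⊆ U, IsOpen W ∧ W.Nonempty ∧ ∀ x ∈ W, ∀ x' ∈ W, ∀ z, |g x z - g x' z| ≤ ε := by
  classical
  have : CompactSpace Z := isCompact_iff_compactSpace.1 hZ
  by_contra hcon
  have hosc : ∀ W ⊆ U, IsOpen W → W.Nonempty →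
      ∃ x ∈ W, ∃ x' ∈ W, ∃ z, ε < |g x z - g x' z| := by
    intro W hWU hW hWne
    by_contra h
    push Not at h
    exact hcon ⟨W, hWU, hW, hWne, h⟩
  set D : Set Z := {z : Z | {s : S | (z : S → ℝ) s ≠ 0}.Countable} with hDdef
  have he : ∀ z : Z, ∃ e : ℕ → Finset S, Monotone e ∧
      (z ∈ D → ∀ s, (z : S → ℝ) s ≠ 0 → ∃ n, s ∈ e n) := by
    intro z
    by_cases hz : z ∈ D
    · obtain ⟨e, hm, he⟩ := Set.Countable.exists_monotone_finset hz
      exact ⟨e, hm, fun _ => he⟩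
    · exact ⟨fun _ => ∅, monotone_const, fun h => absurd h hz⟩
  choose e hem he using he
  refine hX (exists_betaWinning_of_states (St := ℕ × Set X × Finset Z) (fun s => s.2.1)
    (fun s => IsOpen s.2.1 ∧ s.2.1.Nonempty ∧ s.2.1 ⊆ U)
    (fun s p s' => s'.1 = s.1 + 1 ∧ s.2.2 ⊆ s'.2.2 ∧ ∃ y ∈ D, ∃ y' ∈ D, y ∈ s'.2.2 ∧ y' ∈ s'.2.2 ∧
      (∀ t ∈ s.2.2.biUnion fun z => e z s.1,
        |(y : S → ℝ) t - (y' : S → ℝ) t| < 1 / ((s.1 : ℝ) + 1)) ∧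
      ∀ x ∈ s'.2.1, ε / 8 < |g x y - g x y'|)
    (0, U, ∅) ⟨hU, hUne, subset_rfl⟩ (fun s hs => ⟨hs.1, hs.2.1⟩) ?_ ?_)
  · rintro ⟨n, W, L⟩ V Q ⟨-, -, hWU⟩ hV hVne hVW -
    have hVU : V ⊆ U := hVW.trans hWU
    obtain ⟨y, hy, y', hy', hyy', W', hW'V, hW', hW'ne, hlt⟩ :=
      exists_close_pair_of_oscillation hZ hD g hg₁ hV hVne (fun x hx => hg₂ x (hVU hx)) hε
        (fun W' hW' => hosc W' (hW'.trans hVU)) (L.biUnion fun z => e z n)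
        (δ := 1 / ((n : ℝ) + 1)) (by positivity)
    exact ⟨(n + 1, W', insert y (insert y' L)),
      ⟨rfl, fun z hz => by simp [hz], y, hy, y', hy', by simp, by simp, hyy', hlt⟩,
      ⟨hW', hW'ne, hW'V.trans hVU⟩, hW'V⟩
  · intro m s hs₀ hR hI hm x hx _ _
    have hn : ∀ n, (s n).1 = n := by
      intro n
      induction n with
      | zero => rw [hs₀]
      | succ n ih => rw [(hR n).1, ih]
    have hL : Monotone fun n => (s n).2.2 := monotone_nat_of_le_succ fun n => (hR n).2.1
    choose y hy y' hy' hyL hyL' hclose hlt using fun n => (hR n).2.2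
    have hxU : x ∈ U := (hI 0).2.2 (hm 0 (hx 0))
    have hdiff : ∀ t, Tendsto (fun n => (y n : S → ℝ) t - (y' n : S → ℝ) t) atTop (𝓝 0) := by
      intro t
      have key : (∃ k, ∃ z ∈ (s k).2.2, z ∈ D ∧ (z : S → ℝ) t ≠ 0) →
          Tendsto (fun n => (y n : S → ℝ) t - (y' n : S → ℝ) t) atTop (𝓝 0) := by
        rintro ⟨k, z, hzk, hzD, hzt⟩
        obtain ⟨j, hj⟩ := he z hzD t hzt
        refine squeeze_zero_norm' ?_ (tendsto_one_div_add_atTop_nhds_zero_nat (𝕜 := ℝ))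
        filter_upwards [eventually_ge_atTop k, eventually_ge_atTop j] with n hkn hjn
        have := hclose n t (Finset.mem_biUnion.2 ⟨z, hL hkn hzk, by
          rw [hn n]; exact hem z hjn hj⟩)
        rw [hn n] at this
        exact this.le
      by_cases h : ∃ k, ∃ z ∈ (s k).2.2, z ∈ D ∧ (z : S → ℝ) t ≠ 0
      · exact key h
      · push Not at h
        have hzero : ∀ n, (y n : S → ℝ) t - (y' n : S → ℝ) t = 0 := fun n => by
          rw [h (n + 1) _ (hyL n) (hy n), h (n + 1) _ (hyL' n) (hy' n), sub_zero]
        simp only [hzero]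
        exact tendsto_const_nhds
    have hlim : ∀ w : ℕ → Z, ∃ a, Tendsto w (hyperfilter ℕ) (𝓝 a) := fun w => by
      obtain ⟨a, -, ha⟩ := isCompact_univ.ultrafilter_le_nhds ((hyperfilter ℕ).map w) (by simp)
      exact ⟨a, ha⟩
    obtain ⟨a, ha⟩ := hlim y
    obtain ⟨b, hb⟩ := hlim y'
    have hU' : (hyperfilter ℕ : Filter ℕ) ≤ atTop := by
      rw [← Nat.cofinite_eq_atTop]; exact hyperfilter_le_cofinite
    have hab : a = b := by
      refine Subtype.ext (funext fun t => sub_eq_zero.1 ?_)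
      have hc : Continuous fun z : Z => (z : S → ℝ) t :=
        (continuous_apply t).comp continuous_subtype_val
      exact tendsto_nhds_unique (((hc.tendsto a).comp ha).sub ((hc.tendsto b).comp hb))
        ((hdiff t).mono_left hU')
    subst hab
    have hg := hg₂ x hxU
    have h₀ := (((hg.tendsto a).comp ha).sub ((hg.tendsto a).comp hb)).abs
    rw [sub_self, abs_zero] at h₀
    have := ge_of_tendsto' h₀ fun n => (hlt n x (hm (n + 1) (hx (n + 1)))).le
    linarith

/-- If restrictions to `E` of compact sets of continuous functions are Valdivia compact, then a
separately continuous function has small oscillation somewhere in every nonempty open subset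
of the closure of `E`. -/
theorem exists_small_oscillation_of_subset_closure {X : Type u} [TopologicalSpace X]
    (hX : ¬ ∃ σ, BetaWinning ({Set.univ} : Set (Set X)) σ) {E : Set X}
    (hE : ∀ Y : Set (X → ℝ), (∀ y ∈ Y, Continuous y) → IsCompact Y →
      IsValdiviaCompact.{u, u} ((fun (y : X → ℝ) (e : E) => y e) '' Y))
    {K : Type v} [TopologicalSpace K] [CompactSpace K] (f : X → K → ℝ)
    (hf₁ : ∀ k : K, Continuous fun x => f x k) (hf₂ : ∀ x : X, Continuous (f x))
    {U : Set X} (hU : IsOpen U) (hUne : U.Nonempty) (hUE : U ⊆ closure E)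
    {ε : ℝ} (hε : 0 < ε) :
    ∃ W ⊆ U, IsOpen W ∧ W.Nonempty ∧ ∀ x ∈ W, ∀ x' ∈ W, ∀ k, |f x k - f x' k| ≤ ε := by
  set φ : K → X → ℝ := fun k x => f x k with hφdef
  have hφ : Continuous φ := continuous_pi hf₂
  obtain ⟨-, S, Z, hZ, hD, ⟨h⟩⟩ := hE (Set.range φ) (by rintro _ ⟨k, rfl⟩; exact hf₁ k)
    (isCompact_range hφ)
  let q : K → Z := fun k => h ⟨fun e => φ k e, φ k, ⟨k, rfl⟩, rfl⟩
  have hq : Continuous q := h.continuous.comp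
    (Continuous.subtype_mk (continuous_pi fun e : E => hf₂ e) _)
  have hqs : Function.Surjective q := by
    intro z
    obtain ⟨w, rfl⟩ := h.surjective z
    obtain ⟨_, _, ⟨k, rfl⟩, rfl⟩ := w
    exact ⟨k, rfl⟩
  have hquot : IsQuotientMap q := hq.isClosedMap.isQuotientMap hq hqs
  have hfac : ∀ x ∈ U, ∀ k k', q k = q k' → f x k = f x k' := by
    intro x hx k k' hkk'
    have heq : ∀ e ∈ E, f e k = f e k' := fun e he =>
      congrFun (congrArg Subtype.val (h.injective hkk')) ⟨e, he⟩
    exact closure_minimal heq (isClosed_eq (hf₁ k) (hf₁ k')) (hUE hx)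
  let r := Function.surjInv hqs
  have hr : ∀ x ∈ U, ∀ k, f x (r (q k)) = f x k := fun x hx k =>
    hfac x hx _ _ (Function.surjInv_eq hqs _)
  obtain ⟨W, hWU, hW, hWne, hb⟩ := exists_small_oscillation_of_valdivia hX hZ hD
    (fun x z => f x (r z)) (fun z => hf₁ _) hU hUne
    (fun x hx => hquot.continuous_iff.2 ((hf₂ x).congr fun k => (hr x hx k).symm)) hε
  refine ⟨W, hWU, hW, hWne, fun x hx x' hx' k => ?_⟩
  rw [← hr x (hWU hx), ← hr x' (hWU hx')]
  exact hb x hx x' hx' (q k)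

/-- Theorem 4.3: if `X` is `β`-unfavorable in the Choquet game, `𝒫` is a system
of subsets of `X` closed under finite unions such that for every `E ∈ 𝒫` and
every compact `Y ⊆ C_p(X)` the image of `Y` under the restriction map
`C_p(X) → C_p(E)` is a Valdivia compact, and `β` has no winning strategy in the
`G_𝒫`-game, then `X` is a Namioka space. -/
theorem stmt12 {X : Type u} [TopologicalSpace X] (P : Set (Set X))
    (hChoquet : ¬ ∃ σ, BetaWinning ({Set.univ} : Set (Set X)) σ)
    (hUnion : ∀ E₁ ∈ P, ∀ E₂ ∈ P, E₁ ∪ E₂ ∈ P)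
    (hValdivia : ∀ E ∈ P, ∀ Y : Set (X → ℝ), (∀ y ∈ Y, Continuous y) →
      IsCompact Y →
      IsValdiviaCompact.{u, u} ((fun (y : X → ℝ) (e : E) => y e) '' Y))
    (hβ : ¬ ∃ σ, BetaWinning P σ) :
    ∀ (K : Type v) [TopologicalSpace K] [CompactSpace K] (f : X → K → ℝ),
      (∀ k : K, Continuous fun x => f x k) → (∀ x : X, Continuous (f x)) →
      ∃ A : Set X, Dense A ∧ IsGδ A ∧
        ∀ a ∈ A, ∀ k : K, ContinuousAt (fun p : X × K => f p.1 p.2) (a, k) := by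
  intro K _ _ f hf₁ hf₂
  have : BaireSpace X := baireSpace_of_not_betaWinning hChoquet
  let G : ℕ → Set X := fun n => ⋃₀ {W | IsOpen W ∧
    ∀ x ∈ W, ∀ x' ∈ W, ∀ k, |f x k - f x' k| ≤ 1 / ((n : ℝ) + 1)}
  have hGo : ∀ n, IsOpen (G n) := fun n => isOpen_sUnion fun W hW => hW.1
  have hGd : ∀ n, Dense (G n) := by
    intro n
    by_contra hd
    rw [dense_iff_inter_open] at hd
    push Not at hd
    obtain ⟨U, hU, hUne, hUG⟩ := hd
    refine hβ (exists_betaWinning_of_states (St := Set X) id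
      (fun s => IsOpen s ∧ s.Nonempty ∧ s ⊆ U) (fun _ p s' => Disjoint s' p.2) U
      ⟨hU, hUne, subset_rfl⟩ (fun s hs => ⟨hs.1, hs.2.1⟩) ?_ ?_)
    · rintro s V Q ⟨-, -, hsU⟩ hV hVne hVs hQ
      refine ⟨V \ closure Q, Set.disjoint_left.2 fun x hx hxQ => hx.2 (subset_closure hxQ),
        ⟨hV.sdiff isClosed_closure, ?_, Set.sdiff_subset.trans (hVs.trans hsU)⟩, Set.sdiff_subset⟩
      rw [Set.sdiff_nonempty]
      intro hVQ
      obtain ⟨W, hWV, hW, ⟨x, hx⟩, hb⟩ := exists_small_oscillation_of_subset_closure hChoquet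
        (hValdivia Q hQ) f hf₁ hf₂ hV hVne hVQ (ε := 1 / ((n : ℝ) + 1)) (by positivity)
      have : x ∈ U ∩ G n := ⟨hsU (hVs (hWV hx)), W, ⟨hW, hb⟩, hx⟩
      rw [hUG] at this
      exact this
    · intro m s _ hR _ hm x hx n
      exact Set.disjoint_left.1 (hR n) (hm (n + 1) (hx (n + 1)))
  refine ⟨⋂ n, G n, dense_iInter_of_isOpen hGo hGd, .iInter_of_isOpen hGo, fun a ha k => ?_⟩
  rw [Metric.continuousAt_iff']
  intro ε hε
  obtain ⟨n, hn⟩ := exists_nat_one_div_lt (half_pos hε)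
  obtain ⟨W, ⟨hW, hb⟩, haW⟩ := Set.mem_iInter.1 ha n
  have h₁ : ∀ᶠ p : X × K in 𝓝 (a, k), p.1 ∈ W :=
    continuousAt_fst.eventually (hW.mem_nhds haW)
  have h₂ : ∀ᶠ p : X × K in 𝓝 (a, k), dist (f a p.2) (f a k) < ε / 2 :=
    continuousAt_snd.eventually (Metric.continuousAt_iff'.1 (hf₂ a).continuousAt _ (half_pos hε))
  filter_upwards [h₁, h₂] with p hp₁ hp₂
  have h₃ : dist (f p.1 p.2) (f a p.2) < ε / 2 := (hb _ hp₁ _ haW _).trans_lt hn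
  calc dist (f p.1 p.2) (f a k) ≤ dist (f p.1 p.2) (f a p.2) + dist (f a p.2) (f a k) :=
        dist_triangle _ _ _
    _ < ε := by linarith
end
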